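/- For every natural number k, X_{2k} = X_{k+1}² + X_k·(2·X_{k+2} − 2·p·X_{k+1} − q·X_k). -/

import Mathlib

/-- Addition formula for the fundamental solution of a third-order linear recurrence. -/
theorem third_order_recurrence_add (p q r : ℤ) (X : ℕ → ℤ)
    (hX0 : X 0 = 0) (hX1 : X 1 = 0) (hX2 : X 2 = 1)
    (hXrec : ∀ k, X (k + 3) = p * X (k + 2) + q * X (k + 1) + r * X k) (m n : ℕ) :
    X (m + n) = X n * X (m + 2) + (X (n + 1) - p * X n) * X (m + 1)
      + (X (n + 2) - p * X (n + 1) - q * X n) * X m := by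
  induction n generalizing m with
  | zero => simp [hX0, hX1, hX2]
  | succ n ih =>
    have h := ih (m + 1)
    rw [show m + 1 + n = m + (n + 1) by ring, show m + 1 + 2 = m + 3 by ring,
      show m + 1 + 1 = m + 2 by ring, hXrec m] at h
    rw [h, show n + 1 + 2 = n + 3 by ring, show n + 1 + 1 = n + 2 by ring, hXrec n]
    ring

theorem stmt_14 (p q r : ℤ) (X : ℕ → ℤ)
    (hX0 : X 0 = 0) (hX1 : X 1 = 0) (hX2 : X 2 = 1)
    (hXrec : ∀ k, X (k + 3) = p * X (k + 2) + q * X (k + 1) + r * X k) :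
    ∀ k : ℕ, X (2 * k) = X (k + 1) ^ 2 + X k * (2 * X (k + 2) - 2 * p * X (k + 1) - q * X k) := by
  intro k
  rw [two_mul, third_order_recurrence_add p q r X hX0 hX1 hX2 hXrec k k]
  ring
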